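/- (Theorem 2.) The game G is weakly acyclic under better replies: for every action profile b⁰ : M → Option N there exists a finite sequence of profiles b⁰, b¹, …, b^K such that for each k < K the profiles b^k and b^{k+1} differ in the action of exactly one CU m, with π_m b^{k+1} > π_m b^k (i.e., the sequence is a better-reply path), and b^K is a pure Nash equilibrium of G. -/

import Mathlib

open scoped Classical

variable {M N : Type*} [DecidableEq M]

/-- `chosen s b n m` : under profile `b`, CU `m` proposes to D2D pair `n` and is the
(unique, since `s · n` is injective) maximizer of `s · n` among the CUs proposing to `n`;
i.e. `Ch_n b = m`. -/
def chosen (s : M → N → ℝ) (b : M → Option N) (n : N) (m : M) : Prop :=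
  b m = some n ∧ ∀ m', b m' = some n → s m' n ≤ s m n

/-- CU `m`'s payoff `π_m b` in the game `G` (Eq. (8)): `u m n − θ` if its proposal to `n`
is accepted, `−θ` if it is rejected, and `0` if it refuses to cooperate. -/
noncomputable def payoff (u s : M → N → ℝ) (θ : ℝ) (b : M → Option N) (m : M) : ℝ :=
  match b m with
  | none => 0
  | some n => if chosen s b n m then u m n - θ else -θ

/-- A pure Nash equilibrium of `G`: no CU has a profitable unilateral deviation. -/
def isPNE (u s : M → N → ℝ) (θ : ℝ) (b : M → Option N) : Prop :=
  ∀ m (a : Option N), payoff u s θ (Function.update b m a) m ≤ payoff u s θ b m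

/-- The matching `μ_b` induced by an action profile `b`:
`μ_b m = some n` iff `b m = some n` and `Ch_n b = m`. -/
noncomputable def inducedMatching (s : M → N → ℝ) (b : M → Option N) (m : M) : Option N :=
  match b m with
  | none => none
  | some n => if chosen s b n m then some n else none

/-- `μ` is a matching: no two CUs are matched with the same D2D pair. -/
def isMatching (μ : M → Option N) : Prop :=
  ∀ m m' n, μ m = some n → μ m' = some n → m = m'

/-- Individual rationality: every matched CU gets positive utility. -/
def indivRational (u : M → N → ℝ) (μ : M → Option N) : Prop :=
  ∀ m n, μ m = some n → 0 < u m n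

/-- `(m, n)` is a blocking pair for `μ`: they are not matched together, CU `m` strictly
prefers `n` to its current situation, and D2D pair `n` strictly prefers `m` to any CU
currently matched with it. -/
def blocks (u s : M → N → ℝ) (μ : M → Option N) (m : M) (n : N) : Prop :=
  μ m ≠ some n ∧
  (∀ n', μ m = some n' → u m n' < u m n) ∧
  (μ m = none → 0 < u m n) ∧
  (∀ m', μ m' = some n → s m' n < s m n)

/-- `μ` is a stable matching: a matching that is individually rational and admits no
blocking pair. -/
def isStable (u s : M → N → ℝ) (μ : M → Option N) : Prop :=
  isMatching μ ∧ indivRational u μ ∧ ∀ m n, ¬ blocks u s μ m n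

/-- `n` would accept a proposal of `m` under `b`. -/
def Accepts (s : M → N → ℝ) (b : M → Option N) (n : N) (m : M) : Prop :=
  ∀ m', b m' = some n → s m' n ≤ s m n

/-- One step of a better-reply path: a single CU changes its action and strictly gains. -/
def BetterReply (u s : M → N → ℝ) (θ : ℝ) (b b' : M → Option N) : Prop :=
  ∃ (m : M) (a : Option N), a ≠ b m ∧ b' = Function.update b m a ∧
    payoff u s θ b m < payoff u s θ b' m

/-- No CU that currently makes a proposal has a profitable deviation. -/
def ProposersSettled (u s : M → N → ℝ) (θ : ℝ) (b : M → Option N) : Prop :=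
  ∀ m, b m ≠ none → ∀ a, payoff u s θ (Function.update b m a) m ≤ payoff u s θ b m

/-- Every D2D pair receives under `b'` a proposal at least as good as under `b`. -/
def Improves (s : M → N → ℝ) (b b' : M → Option N) : Prop :=
  ∀ m n, b m = some n → ∃ m', b' m' = some n ∧ s m n ≤ s m' n

section Payoff

variable {M N : Type*} {u s : M → N → ℝ} {θ : ℝ} {b b' : M → Option N} {m : M} {n : N}

theorem payoff_of_none (h : b m = none) : payoff u s θ b m = 0 := by
  simp [payoff, h]

theorem payoff_of_chosen (h : chosen s b n m) : payoff u s θ b m = u m n - θ := by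
  simp [payoff, h.1, h]

theorem payoff_of_not_chosen (hb : b m = some n) (h : ¬ chosen s b n m) :
    payoff u s θ b m = -θ := by
  simp [payoff, hb, h]

theorem chosen_of_payoff_nonneg (hθ : 0 < θ) (hb : b m = some n)
    (h : 0 ≤ payoff u s θ b m) : chosen s b n m := by
  by_contra hc
  rw [payoff_of_not_chosen hb hc] at h
  linarith

theorem Improves.trans {b'' : M → Option N} (h : Improves s b b') (h' : Improves s b' b'') :
    Improves s b b'' := fun m n hm => by
  obtain ⟨m₁, hm₁, h₁⟩ := h m n hm
  obtain ⟨m₂, hm₂, h₂⟩ := h' m₁ n hm₁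
  exact ⟨m₂, hm₂, h₁.trans h₂⟩

variable [DecidableEq M]

theorem chosen_update_iff :
    chosen s (Function.update b m (some n)) n m ↔
      ∀ m', m' ≠ m → b m' = some n → s m' n ≤ s m n := by
  constructor
  · intro h m' hm hb
    exact h.2 m' (by simpa [Function.update_of_ne hm] using hb)
  · refine fun h => ⟨by simp, fun m' hb => ?_⟩
    by_cases hm : m' = m
    · rw [hm]
    · exact h m' hm (by simpa [Function.update_of_ne hm] using hb)

theorem chosen_update_iff_accepts :
    chosen s (Function.update b m (some n)) n m ↔ Accepts s b n m := by
  rw [chosen_update_iff]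
  refine ⟨fun h m' hb => ?_, fun h m' _ hb => h m' hb⟩
  by_cases hm : m' = m
  · rw [hm]
  · exact h m' hm hb

theorem betterReply_of_payoff_lt {a : Option N}
    (h : payoff u s θ b m < payoff u s θ (Function.update b m a) m) :
    BetterReply u s θ b (Function.update b m a) := by
  refine ⟨m, a, ?_, rfl, h⟩
  rintro rfl
  simp at h

theorem betterReply_refuse (h : payoff u s θ b m < 0) :
    BetterReply u s θ b (Function.update b m none) :=
  betterReply_of_payoff_lt (by rwa [payoff_of_none (b := Function.update b m none) (by simp)])

theorem ProposersSettled.payoff_nonneg (h : ProposersSettled u s θ b) (m : M) :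
    0 ≤ payoff u s θ b m := by
  by_cases hm : b m = none
  · rw [payoff_of_none hm]
  · have := h m hm none
    rwa [payoff_of_none (by simp)] at this

theorem ProposersSettled.eq_of_eq_some (h : ProposersSettled u s θ b) (hθ : 0 < θ)
    (hs : ∀ n, Function.Injective fun m => s m n) {m m' : M}
    (hm : b m = some n) (hm' : b m' = some n) : m = m' :=
  hs n (le_antisymm
    ((chosen_of_payoff_nonneg hθ hm' (h.payoff_nonneg m')).2 m hm)
    ((chosen_of_payoff_nonneg hθ hm (h.payoff_nonneg m)).2 m' hm'))

/-- Deviations only lose value when the D2D pairs receive better proposals. -/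
theorem Improves.payoff_update_le (h : Improves s b b') (hθ : 0 < θ) {p : ℝ} (hp : 0 ≤ p)
    (hb : ∀ a, payoff u s θ (Function.update b m a) m ≤ p) (a : Option N) :
    payoff u s θ (Function.update b' m a) m ≤ p := by
  cases a with
  | none => rwa [payoff_of_none (by simp)]
  | some k =>
    by_cases hc : chosen s (Function.update b' m (some k)) k m
    · have hacc : Accepts s b k m := fun m₀ hm₀ => by
        obtain ⟨m₁, hm₁, hle⟩ := h m₀ k hm₀
        exact hle.trans (chosen_update_iff_accepts.1 hc m₁ hm₁)
      have := hb (some k)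
      rw [payoff_of_chosen (chosen_update_iff_accepts.2 hacc)] at this
      rwa [payoff_of_chosen hc]
    · rw [payoff_of_not_chosen (by simp) hc]
      linarith

end Payoff

section Displacement

/-- The profile in which `m` proposes to `n` and all earlier proposers to `n` have given up. -/
noncomputable def displace (b : M → Option N) (m : M) (n : N) : M → Option N :=
  Function.update (fun x => if b x = some n then none else b x) m (some n)

variable {u s : M → N → ℝ} {θ : ℝ} {b : M → Option N} {m : M} {n : N}

theorem displace_self : displace b m n m = some n := by simp [displace]

theorem displace_eq_some {x : M} {k : N} (hx : x ≠ m) :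
    displace b m n x = some k ↔ b x = some k ∧ k ≠ n := by
  rw [displace, Function.update_of_ne hx]
  split_ifs with h
  · simp only [h, Option.some.injEq, false_iff]
    rintro ⟨rfl, h⟩
    exact h rfl
  · refine ⟨fun hk => ⟨hk, ?_⟩, And.left⟩
    rintro rfl
    exact h hk

theorem improves_displace (hm : b m = none) (hacc : Accepts s b n m) :
    Improves s b (displace b m n) := fun x k hx => by
  have hxm : x ≠ m := by rintro rfl; simp [hm] at hx
  by_cases hk : k = n
  · subst hk
    exact ⟨m, displace_self, hacc x hx⟩
  · exact ⟨x, (displace_eq_some hxm).2 ⟨hx, hk⟩, le_rfl⟩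

theorem not_displace_improves (hs : ∀ n, Function.Injective fun m => s m n)
    (hm : b m = none) (hacc : Accepts s b n m) : ¬ Improves s (displace b m n) b := fun h => by
  obtain ⟨x, hx, hle⟩ := h m n displace_self
  obtain rfl : m = x := hs n (le_antisymm hle (hacc x hx))
  simp [hm] at hx

theorem proposersSettled_displace (hθ : 0 < θ) (h : ProposersSettled u s θ b)
    (hm : b m = none) (hacc : Accepts s b n m) (hpos : 0 < u m n - θ)
    (hmax : ∀ a, payoff u s θ (Function.update b m a) m ≤ u m n - θ) :
    ProposersSettled u s θ (displace b m n) := by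
  have himp := improves_displace hm hacc
  intro x hx a
  by_cases hxm : x = m
  · subst hxm
    have hc : chosen s (displace b x n) n x := by
      refine ⟨displace_self, fun y hy => ?_⟩
      by_cases hyx : y = x
      · rw [hyx]
      · exact hacc y ((displace_eq_some hyx).1 hy).1
    rw [payoff_of_chosen hc]
    exact himp.payoff_update_le hθ hpos.le hmax a
  · obtain ⟨k, hk⟩ := Option.ne_none_iff_exists'.1 hx
    obtain ⟨hbk, hkn⟩ := (displace_eq_some hxm).1 hk
    have hc := chosen_of_payoff_nonneg hθ hbk (h.payoff_nonneg x)
    have hc' : chosen s (displace b m n) k x := by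
      refine ⟨hk, fun y hy => ?_⟩
      have hym : y ≠ m := by
        rintro rfl
        rw [displace_self] at hy
        exact hkn (Option.some.inj hy).symm
      exact hc.2 y ((displace_eq_some hym).1 hy).1
    have hset := h x (by simp [hbk])
    have hnn := h.payoff_nonneg x
    rw [payoff_of_chosen hc] at hset hnn
    rw [payoff_of_chosen hc']
    exact himp.payoff_update_le hθ hnn hset a

theorem reachable_displace (hθ : 0 < θ) (hs : ∀ n, Function.Injective fun m => s m n)
    (h : ProposersSettled u s θ b) (hm : b m = none) (hacc : Accepts s b n m)
    (hpos : 0 < u m n - θ) :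
    Relation.ReflTransGen (BetterReply u s θ) b (displace b m n) := by
  have hstep : BetterReply u s θ b (Function.update b m (some n)) :=
    betterReply_of_payoff_lt (by
      rwa [payoff_of_none hm, payoff_of_chosen (chosen_update_iff_accepts.2 hacc)])
  by_cases hn : ∃ x, b x = some n
  · obtain ⟨x, hx⟩ := hn
    have hxm : x ≠ m := by rintro rfl; simp [hm] at hx
    have heq : displace b m n = Function.update (Function.update b m (some n)) x none := by
      funext y
      by_cases hyx : y = x
      · subst hyx
        simp [displace, hxm, hx]
      · by_cases hym : y = m
        · subst hym
          simp [displace, hyx]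
        · have : b y ≠ some n := fun hy => hyx (h.eq_of_eq_some hθ hs hy hx)
          simp [displace, hyx, hym, this]
    rw [heq]
    refine .tail (.single hstep) (betterReply_refuse ?_)
    have hx' : Function.update b m (some n) x = some n := by
      rwa [Function.update_of_ne hxm]
    rw [payoff_of_not_chosen hx' fun hc => ?_]
    · linarith
    · exact hxm (hs n (le_antisymm (hacc x hx) (hc.2 m (by simp))))
  · have heq : displace b m n = Function.update b m (some n) := by
      funext y
      by_cases hym : y = m
      · subst hym
        simp [displace]
      · have : b y ≠ some n := fun hy => hn ⟨y, hy⟩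
        simp [displace, hym, this]
    rw [heq]
    exact .single hstep

end Displacement

section Termination

variable [Fintype M] {u s : M → N → ℝ} {θ : ℝ}

/-- The number of CUs that make a proposal. -/
noncomputable def numProposers (b : M → Option N) : ℕ :=
  ∑ m, (b m).elim 0 fun _ => 1

/-- The total utility of all proposals, counting refused ones as well. -/
noncomputable def totalUtility (u : M → N → ℝ) (b : M → Option N) : ℝ :=
  ∑ m, (b m).elim 0 (u m)

theorem numProposers_update_none_lt {b : M → Option N} {m : M} (hm : b m ≠ none) :
    numProposers (Function.update b m none) < numProposers b := by
  obtain ⟨n, hn⟩ := Option.ne_none_iff_exists'.1 hm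
  refine Finset.sum_lt_sum (fun x _ => ?_) ⟨m, Finset.mem_univ m, by simp [hn]⟩
  by_cases hx : x = m
  · subst hx
    simp
  · simp [hx]

theorem numProposers_update_some {b : M → Option N} {m : M} (hm : b m ≠ none) (n : N) :
    numProposers (Function.update b m (some n)) = numProposers b := by
  obtain ⟨k, hk⟩ := Option.ne_none_iff_exists'.1 hm
  refine Finset.sum_congr rfl fun x _ => ?_
  by_cases hx : x = m
  · subst hx
    simp [hk]
  · simp [hx]

theorem totalUtility_lt_update {b : M → Option N} {m : M} {n k : N} (hm : b m = some k)
    (h : u m k < u m n) : totalUtility u b < totalUtility u (Function.update b m (some n)) := by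
  refine Finset.sum_lt_sum (fun x _ => ?_) ⟨m, Finset.mem_univ m, by simpa [hm] using h⟩
  by_cases hx : x = m
  · subst hx
    simpa [hm] using h.le
  · simp [hx]

variable [Finite N]

theorem exists_reachable_proposersSettled (hθ : 0 < θ) (b : M → Option N) :
    ∃ b', Relation.ReflTransGen (BetterReply u s θ) b b' ∧ ProposersSettled u s θ b' := by
  let r : (M → Option N) → (M → Option N) → Prop := fun b' b =>
    numProposers b' < numProposers b ∨
      numProposers b' = numProposers b ∧ totalUtility u b < totalUtility u b'
  have : IsTrans _ r := ⟨fun a b c hab hbc => by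
    rcases hab with h | ⟨h, h'⟩ <;> rcases hbc with k | ⟨k, k'⟩
    · exact .inl (h.trans k)
    · exact .inl (k ▸ h)
    · exact .inl (h ▸ k)
    · exact .inr ⟨h.trans k, k'.trans h'⟩⟩
  have : Std.Irrefl r := ⟨fun a h => by simp [r] at h⟩
  have wf : WellFounded r := Finite.wellFounded_of_trans_of_irrefl r
  induction b using wf.induction with
  | _ b ih =>
    by_cases hset : ProposersSettled u s θ b
    · exact ⟨b, .refl, hset⟩
    suffices ∃ c, BetterReply u s θ b c ∧ r c b by
      obtain ⟨c, hc, hr⟩ := this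
      obtain ⟨b', hb', h⟩ := ih c hr
      exact ⟨b', .head hc hb', h⟩
    by_cases hneg : ∃ m, payoff u s θ b m < 0
    · obtain ⟨m, hm⟩ := hneg
      refine ⟨_, betterReply_refuse hm, .inl (numProposers_update_none_lt fun h => ?_)⟩
      rw [payoff_of_none h] at hm
      exact hm.false
    · push Not at hneg
      unfold ProposersSettled at hset
      push Not at hset
      obtain ⟨m, hm, a, ha⟩ := hset
      refine ⟨_, betterReply_of_payoff_lt ha, ?_⟩
      cases a with
      | none => exact .inl (numProposers_update_none_lt hm)
      | some n =>
        obtain ⟨k, hk⟩ := Option.ne_none_iff_exists'.1 hm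
        refine .inr ⟨numProposers_update_some hm n, totalUtility_lt_update hk ?_⟩
        have hc := chosen_of_payoff_nonneg hθ hk (hneg m)
        have hc' := chosen_of_payoff_nonneg (n := n) hθ (by simp) ((hneg m).trans ha.le)
        rw [payoff_of_chosen hc, payoff_of_chosen hc'] at ha
        linarith

theorem ProposersSettled.exists_reachable_isPNE (hθ : 0 < θ)
    (hs : ∀ n, Function.Injective fun m => s m n) (b : M → Option N)
    (h : ProposersSettled u s θ b) :
    ∃ b', Relation.ReflTransGen (BetterReply u s θ) b b' ∧ isPNE u s θ b' := by
  let r : (M → Option N) → (M → Option N) → Prop := fun b' b =>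
    Improves s b b' ∧ ¬ Improves s b' b
  have : IsTrans _ r := ⟨fun a b c hab hbc =>
    ⟨hbc.1.trans hab.1, fun hac => hab.2 (hac.trans hbc.1)⟩⟩
  have : Std.Irrefl r := ⟨fun a h => h.2 h.1⟩
  have wf : WellFounded r := Finite.wellFounded_of_trans_of_irrefl r
  induction b using wf.induction with
  | _ b ih =>
    by_cases hpne : isPNE u s θ b
    · exact ⟨b, .refl, hpne⟩
    unfold isPNE at hpne
    push Not at hpne
    obtain ⟨m, a, ha⟩ := hpne
    have hm : b m = none := by
      by_contra hm
      exact (h m hm a).not_gt ha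
    obtain ⟨best, hbest⟩ :=
      Finite.exists_max fun a => payoff u s θ (Function.update b m a) m
    have hpos := ha.trans_le (hbest a)
    rw [payoff_of_none hm] at hpos
    cases best with
    | none =>
      rw [payoff_of_none (by simp)] at hpos
      exact absurd hpos (lt_irrefl 0)
    | some n =>
      have hc := chosen_of_payoff_nonneg (n := n) hθ (by simp) hpos.le
      rw [payoff_of_chosen hc] at hpos
      simp only [payoff_of_chosen hc] at hbest
      have hacc := chosen_update_iff_accepts.1 hc
      obtain ⟨b', hb', hb'_pne⟩ := ih (displace b m n)
        ⟨improves_displace hm hacc, not_displace_improves hs hm hacc⟩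
        (proposersSettled_displace hθ h hm hacc hpos hbest)
      exact ⟨b', (reachable_displace hθ hs h hm hacc hpos).trans hb', hb'_pne⟩

end Termination

theorem exists_seq_of_reflTransGen {α : Type*} {r : α → α → Prop} {x y : α}
    (h : Relation.ReflTransGen r x y) :
    ∃ (K : ℕ) (seq : ℕ → α), seq 0 = x ∧ (∀ k < K, r (seq k) (seq (k + 1))) ∧ seq K = y := by
  induction h using Relation.ReflTransGen.head_induction_on with
  | refl => exact ⟨0, fun _ => y, rfl, by simp, rfl⟩
  | @head a _ hr _ ih =>
    obtain ⟨K, seq, rfl, hstep, hK⟩ := ih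
    refine ⟨K + 1, fun k => Nat.casesOn k a seq, rfl, fun k hk => ?_, hK⟩
    cases k with
    | zero => exact hr
    | succ k => exact hstep k (by omega)

/-- Theorem 2: the game `G` is weakly acyclic under better replies: from every action
profile `b⁰` there is a finite better-reply path (each step changes exactly one CU's
action and strictly improves that CU's payoff) terminating in a pure Nash equilibrium. -/
theorem weakly_acyclic_under_better_replies
    {M N : Type*} [Fintype M] [Nonempty M] [DecidableEq M] [Fintype N] [Nonempty N]
    (u s : M → N → ℝ) (θ : ℝ)
    (hs : ∀ n, Function.Injective fun m => s m n)
    (hθ : 0 < θ) (hθu : ∀ m n, 0 < u m n → θ < u m n) :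
    ∀ b0 : M → Option N, ∃ (K : ℕ) (seq : ℕ → M → Option N),
      seq 0 = b0 ∧
      (∀ k < K, ∃ (m : M) (a : Option N), a ≠ seq k m ∧
        seq (k + 1) = Function.update (seq k) m a ∧
        payoff u s θ (seq k) m < payoff u s θ (seq (k + 1)) m) ∧
      isPNE u s θ (seq K) := by
  intro b0
  obtain ⟨b₁, h₁, hset⟩ := exists_reachable_proposersSettled (u := u) (s := s) hθ b0
  obtain ⟨b₂, h₂, hpne⟩ := ProposersSettled.exists_reachable_isPNE hθ hs b₁ hset
  obtain ⟨K, seq, hzero, hstep, rfl⟩ := exists_seq_of_reflTransGen (h₁.trans h₂)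
  exact ⟨K, seq, hzero, hstep, hpne⟩
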